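/- arXiv:2401.15502 — 6 statements merged into one kernel-verified Lean document; each statement's English description precedes it below -/
import Mathlib

section
/- Let ε > 0 and Δ > 0, set b = Δ/ε, and let μ denote the measure on ℝ given by Lebesgue measure with density x ↦ (1/(2b)) exp(−|x|/b) (the centered Laplace distribution with scale b). Then for all real numbers u, v with |u − v| ≤ Δ and every Borel set S ⊆ ℝ, the laws of u + η and v + η, where η ∼ μ, satisfy P(u + η ∈ S) ≤ exp(ε) · P(v + η ∈ S). Consequently, adding Laplace(0, Δ/ε) noise to a real-valued statistic whose value changes by at most Δ between neighboring databases yields an ε-differentially private output. -/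
open MeasureTheory

/-- The law of a translated density, written as an integral of the translated density. -/
theorem withDensity_preimage_add_left (f : ℝ → ENNReal) (u : ℝ) {S : Set ℝ}
    (hS : MeasurableSet S) :
    (volume.withDensity f) {x : ℝ | u + x ∈ S} = ∫⁻ y in S, f (y - u) := by
  have hT : MeasurableSet {x : ℝ | u + x ∈ S} := measurable_const_add u hS
  rw [withDensity_apply f hT, ← lintegral_indicator hT, ← lintegral_indicator hS,
    ← lintegral_add_left_eq_self (S.indicator fun y => f (y - u)) u]
  refine lintegral_congr fun x => ?_
  by_cases hx : u + x ∈ S <;> simp [Set.indicator, hx]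

/-- The Laplace densities centered at two points at distance at most `Δ` differ at most by the
factor `exp ε`. -/
theorem laplace_density_le {ε Δ : ℝ} (hε : 0 < ε) (hΔ : 0 < Δ) {u v : ℝ}
    (huv : |u - v| ≤ Δ) (y : ℝ) :
    (1 / (2 * (Δ / ε))) * Real.exp (-|y - u| / (Δ / ε)) ≤
      Real.exp ε * ((1 / (2 * (Δ / ε))) * Real.exp (-|y - v| / (Δ / ε))) := by
  have hb : 0 < Δ / ε := div_pos hΔ hε
  rw [mul_left_comm, ← Real.exp_add]
  gcongr
  have hεb : ε = Δ / (Δ / ε) := by field_simp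
  have htri : |y - v| ≤ |y - u| + |u - v| := abs_sub_le y u v
  calc -|y - u| / (Δ / ε) ≤ (Δ + -|y - v|) / (Δ / ε) := by gcongr; linarith
    _ = ε + -|y - v| / (Δ / ε) := by rw [add_div, ← hεb]

/-- The Laplace mechanism is ε-differentially private: adding centered Laplace noise of
scale `Δ/ε` to a statistic whose value changes by at most `Δ` between neighboring
databases changes output probabilities by at most `exp ε`. -/
theorem laplace_mechanism_dp (ε Δ : ℝ) (hε : 0 < ε) (hΔ : 0 < Δ) :
    ∀ u v : ℝ, |u - v| ≤ Δ → ∀ S : Set ℝ, MeasurableSet S →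
      (volume.withDensity fun x : ℝ =>
          ENNReal.ofReal ((1 / (2 * (Δ / ε))) * Real.exp (-|x| / (Δ / ε))))
        {x : ℝ | u + x ∈ S}
      ≤ ENNReal.ofReal (Real.exp ε) *
        (volume.withDensity fun x : ℝ =>
          ENNReal.ofReal ((1 / (2 * (Δ / ε))) * Real.exp (-|x| / (Δ / ε))))
        {x : ℝ | v + x ∈ S} := by
  intro u v huv S hS
  rw [withDensity_preimage_add_left _ u hS, withDensity_preimage_add_left _ v hS,
    ← lintegral_const_mul' _ _ ENNReal.ofReal_ne_top]
  refine lintegral_mono fun y => ?_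
  rw [← ENNReal.ofReal_mul (Real.exp_nonneg ε)]
  exact ENNReal.ofReal_le_ofReal (laplace_density_le hε hΔ huv y)
end

section
/- For all real numbers a ≥ c > 0, b ≥ 1, and 0 ≤ x < 1, the Gaussian hypergeometric series Σ_{k=0}^∞ ((a)_k (b)_k / ((c)_k · k!)) x^k converges and satisfies Σ_{k=0}^∞ ((a)_k (b)_k / ((c)_k · k!)) x^k ≥ exp(b x); i.e., ₂F₁(a, b; c; x) ≥ e^{bx}. -/
theorem pow_le_ascPochhammer_eval {b : ℝ} (hb : 0 ≤ b) (k : ℕ) :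
    b ^ k ≤ (ascPochhammer ℝ k).eval b := by
  induction k with
  | zero => simp
  | succ k ih =>
    rw [ascPochhammer_succ_eval, pow_succ]
    exact mul_le_mul ih (le_add_of_nonneg_right k.cast_nonneg) hb ((pow_nonneg hb k).trans ih)

theorem ascPochhammer_eval_le_eval {a c : ℝ} (hc : 0 < c) (hca : c ≤ a) (k : ℕ) :
    (ascPochhammer ℝ k).eval c ≤ (ascPochhammer ℝ k).eval a := by
  induction k with
  | zero => simp
  | succ k ih =>
    rw [ascPochhammer_succ_eval, ascPochhammer_succ_eval]
    have := (ascPochhammer_pos k a (hc.trans_le hca)).le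
    gcongr

theorem tendsto_add_natCast_div_add_natCast (a c : ℝ) :
    Filter.Tendsto (fun n : ℕ => (a + n) / (c + n)) Filter.atTop (nhds 1) := by
  simpa using tendsto_add_mul_div_add_mul_atTop_nhds a c 1 (one_ne_zero (α := ℝ))

theorem summable_hypergeometric {a b c x : ℝ} (hc : 0 < c) (hx : |x| < 1) :
    Summable (fun k : ℕ =>
      (ascPochhammer ℝ k).eval a * (ascPochhammer ℝ k).eval b /
        ((ascPochhammer ℝ k).eval c * (k.factorial : ℝ)) * x ^ k) := by
  have hlim : Filter.Tendsto
      (fun n : ℕ => ‖(a + n) / (c + n) * ((b + n) / (1 + n)) * x‖) Filter.atTop (nhds |x|) := by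
    simpa using (((tendsto_add_natCast_div_add_natCast a c).mul
      (tendsto_add_natCast_div_add_natCast b 1)).mul_const x).norm
  obtain ⟨r, hxr, hr⟩ := exists_between hx
  refine summable_of_ratio_norm_eventually_le hr ?_
  filter_upwards [hlim.eventually_le_const hxr] with n hn
  have hcn : c + n ≠ 0 := by positivity
  have hpn := (ascPochhammer_pos n c hc).ne'
  calc
    _ = ‖(a + n) / (c + n) * ((b + n) / (1 + n)) * x‖ *
        ‖(ascPochhammer ℝ n).eval a * (ascPochhammer ℝ n).eval b /
          ((ascPochhammer ℝ n).eval c * (n.factorial : ℝ)) * x ^ n‖ := by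
      rw [← norm_mul]
      congr 1
      simp only [ascPochhammer_succ_eval, Nat.factorial_succ]
      push_cast
      field_simp
      ring
    _ ≤ _ := by gcongr


/-- For `a ≥ c > 0`, `b ≥ 1` and `0 ≤ x < 1`, the Gaussian hypergeometric series
`₂F₁(a, b; c; x)` converges and satisfies `₂F₁(a, b; c; x) ≥ e^{bx}`. -/
theorem twoF_one_ge_exp (a b c x : ℝ) (hc : 0 < c) (hca : c ≤ a) (hb : 1 ≤ b)
    (hx0 : 0 ≤ x) (hx1 : x < 1) :
    Summable (fun k : ℕ =>
      (ascPochhammer ℝ k).eval a * (ascPochhammer ℝ k).eval b /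
        ((ascPochhammer ℝ k).eval c * (k.factorial : ℝ)) * x ^ k) ∧
    Real.exp (b * x) ≤ ∑' k : ℕ,
      (ascPochhammer ℝ k).eval a * (ascPochhammer ℝ k).eval b /
        ((ascPochhammer ℝ k).eval c * (k.factorial : ℝ)) * x ^ k := by
  have hsum := summable_hypergeometric (a := a) (b := b) hc (abs_lt.2 ⟨by linarith, hx1⟩)
  refine ⟨hsum, ?_⟩
  rw [Real.exp_eq_exp_ℝ, NormedSpace.exp_eq_tsum_div]
  refine (NormedSpace.expSeries_div_summable (b * x)).tsum_le_tsum (fun k => ?_) hsum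
  have hck := ascPochhammer_pos k c hc
  have hbk := pow_le_ascPochhammer_eval (zero_le_one.trans hb) k
  calc
    (b * x) ^ k / (k.factorial : ℝ) = 1 * (b ^ k / k.factorial * x ^ k) := by
      rw [mul_pow]; ring
    _ ≤ (ascPochhammer ℝ k).eval a / (ascPochhammer ℝ k).eval c *
        ((ascPochhammer ℝ k).eval b / k.factorial * x ^ k) := by
      have hone := (one_le_div hck).2 (ascPochhammer_eval_le_eval hc hca k)
      exact mul_le_mul hone (by gcongr) (by positivity) (zero_le_one.trans hone)
    _ = _ := by field_simp
end

section
/- Let τ > 0 and z ∈ ℝ. Then ∫_{−∞}^{∞} (2π)^{−1/2} exp(−(z−λ)²/2) · [λ² exp(−λ²/(2τ²)) / ((2τ²)^{3/2} Γ(3/2))] dλ = (2π)^{−1/2} exp(−z²/2) · (1+τ²)^{−3/2} · ₁F₁(3/2; 1/2; τ² z² / (2(1+τ²))). In words: the marginal density of a z-statistic z | λ ∼ N(λ, 1) with λ drawn from the normal-moment prior J(τ²) equals the standard normal density at z times (1+τ²)^{−3/2} ₁F₁(3/2; 1/2; τ²z²/(2(1+τ²))). -/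
/-- The confluent hypergeometric series `₁F₁(a; c; x)`. -/
noncomputable def oneF₁ (a c x : ℝ) : ℝ :=
  ∑' k : ℕ, (ascPochhammer ℝ k).eval a / ((ascPochhammer ℝ k).eval c * (k.factorial : ℝ)) * x ^ k

open MeasureTheory ProbabilityTheory

/-- Raising the numerator parameter by one above the denominator parameter:
`(c + 1)_k * c = (c)_k * (c + k)`. -/
lemma ascPochhammer_eval_add_one_mul (c : ℝ) (k : ℕ) :
    (ascPochhammer ℝ k).eval (c + 1) * c = (ascPochhammer ℝ k).eval c * (c + k) := by
  rw [← ascPochhammer_succ_eval, ascPochhammer_succ_left]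
  simp [mul_comm]

lemma oneF₁_add_one {c : ℝ} (hc : 0 < c) (x : ℝ) :
    oneF₁ (c + 1) c x = (1 + x / c) * Real.exp x := by
  have hexp : HasSum (fun k : ℕ => x ^ k / (k.factorial : ℝ)) (Real.exp x) := by
    rw [Real.exp_eq_exp_ℝ]
    exact NormedSpace.expSeries_div_hasSum_exp x
  have hk : HasSum (fun k : ℕ => (k : ℝ) * (x ^ k / (k.factorial : ℝ))) (x * Real.exp x) := by
    rw [← hasSum_nat_add_iff' 1]
    convert! hexp.mul_left x using 1
    · funext k
      rw [Nat.factorial_succ]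
      push_cast
      field_simp
      ring
    · simp
  unfold oneF₁
  have h := hexp.add (hk.mul_left c⁻¹)
  rw [show (1 + x / c) * Real.exp x = Real.exp x + c⁻¹ * (x * Real.exp x) by ring, ← h.tsum_eq]
  refine tsum_congr fun k => ?_
  have hP := (ascPochhammer_pos k c hc).ne'
  have hkf : (k.factorial : ℝ) ≠ 0 := by positivity
  have e := ascPochhammer_eval_add_one_mul c k
  rw [← eq_div_iff hc.ne'] at e
  rw [e]
  field_simp

lemma integral_sq_gaussianReal (m : ℝ) (v : NNReal) :
    ∫ x, x ^ 2 ∂gaussianReal m v = v + m ^ 2 := by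
  have h := variance_eq_sub (memLp_id_gaussianReal (μ := m) (v := v) 2)
  rw [variance_id_gaussianReal] at h
  simp only [Pi.pow_apply, id_eq, integral_id_gaussianReal] at h
  linarith

lemma integral_sq_mul_gaussianPDFReal (m : ℝ) {v : NNReal} (hv : v ≠ 0) :
    ∫ x, gaussianPDFReal m v x * x ^ 2 = v + m ^ 2 := by
  rw [← integral_sq_gaussianReal, integral_gaussianReal_eq_integral_smul hv]
  simp only [smul_eq_mul]

lemma rpow_three_halves {x : ℝ} (hx : 0 ≤ x) : x ^ ((3 : ℝ) / 2) = √x ^ 3 := by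
  rw [Real.sqrt_eq_rpow, ← Real.rpow_natCast, ← Real.rpow_mul hx]
  norm_num

lemma Real.Gamma_three_halves : Real.Gamma (3 / 2) = √Real.pi / 2 := by
  rw [show (3 / 2 : ℝ) = 1 / 2 + 1 by norm_num, Real.Gamma_add_one (by norm_num),
    Real.Gamma_one_half_eq]
  ring

/-- Marginal density of a z-statistic `z | λ ∼ N(λ, 1)` with `λ` drawn from the
normal-moment prior `J(τ²)`: it equals the standard normal density at `z` times
`(1+τ²)^{−3/2} ₁F₁(3/2; 1/2; τ²z²/(2(1+τ²)))`. -/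
theorem z_marginal_normal_moment (τ z : ℝ) (hτ : 0 < τ) :
    ∫ l : ℝ, (2 * Real.pi) ^ (-(1:ℝ)/2) * Real.exp (-(z - l)^2 / 2) *
        (l^2 * Real.exp (-l^2 / (2 * τ^2)) / ((2 * τ^2) ^ ((3:ℝ)/2) * Real.Gamma (3/2)))
      = (2 * Real.pi) ^ (-(1:ℝ)/2) * Real.exp (-z^2 / 2) * (1 + τ^2) ^ (-(3:ℝ)/2) *
        oneF₁ (3/2) (1/2) (τ^2 * z^2 / (2 * (1 + τ^2))) := by
  have hs : 0 < 1 + τ ^ 2 := by positivity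
  set v : NNReal := ⟨τ ^ 2 / (1 + τ ^ 2), by positivity⟩
  have hv : (v : ℝ) = τ ^ 2 / (1 + τ ^ 2) := rfl
  have hv0 : v ≠ 0 := by
    rw [← NNReal.coe_ne_zero, hv]
    positivity
  have hsqrt : √(2 * Real.pi * v) = √2 * √Real.pi * (τ / √(1 + τ ^ 2)) := by
    rw [Real.sqrt_mul (by positivity), Real.sqrt_mul (by norm_num), hv, Real.sqrt_div (by positivity),
      Real.sqrt_sq hτ.le]
  have hsqrt0 : √(2 * Real.pi * v) ≠ 0 := by
    rw [hsqrt]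
    positivity
  have hintegrand : ∀ l : ℝ, (2 * Real.pi) ^ (-(1:ℝ)/2) * Real.exp (-(z - l)^2 / 2) *
        (l^2 * Real.exp (-l^2 / (2 * τ^2)) / ((2 * τ^2) ^ ((3:ℝ)/2) * Real.Gamma (3/2)))
      = (2 * Real.pi) ^ (-(1:ℝ)/2) * Real.exp (-z ^ 2 / 2) * Real.exp (v * z ^ 2 / 2) *
          √(2 * Real.pi * v) / ((2 * τ^2) ^ ((3:ℝ)/2) * Real.Gamma (3/2)) *
          (gaussianPDFReal (v * z) v l * l ^ 2) := by
    intro l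
    have hexp : Real.exp (-(z - l)^2 / 2) * Real.exp (-l^2 / (2 * τ^2)) =
        Real.exp (-z ^ 2 / 2) * Real.exp (v * z ^ 2 / 2) *
          Real.exp (-(l - v * z) ^ 2 / (2 * v)) := by
      rw [← Real.exp_add, ← Real.exp_add, ← Real.exp_add, hv]
      congr 1
      field_simp
      ring
    rw [gaussianPDFReal]
    calc _ = (2 * Real.pi) ^ (-(1:ℝ)/2) * (Real.exp (-(z - l)^2 / 2) *
            Real.exp (-l^2 / (2 * τ^2))) * l ^ 2 /
            ((2 * τ^2) ^ ((3:ℝ)/2) * Real.Gamma (3/2)) := by ring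
      _ = _ := by
        rw [hexp]
        field_simp
  simp_rw [hintegrand]
  rw [integral_const_mul, integral_sq_mul_gaussianPDFReal _ hv0, hsqrt,
    show (3 / 2 : ℝ) = 1 / 2 + 1 by norm_num, oneF₁_add_one (by norm_num),
    show (1 / 2 + 1 : ℝ) = 3 / 2 by norm_num, Real.Gamma_three_halves,
    neg_div 2 (3 : ℝ), Real.rpow_neg hs.le, rpow_three_halves hs.le, rpow_three_halves (by positivity),
    Real.sqrt_mul (by norm_num), Real.sqrt_sq hτ.le,
    show τ ^ 2 * z ^ 2 / (2 * (1 + τ ^ 2)) = v * z ^ 2 / 2 by rw [hv]; field_simp]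
  have h2 : √2 ^ 2 = (2 : ℝ) := Real.sq_sqrt (by norm_num)
  have hs2 : √(1 + τ ^ 2) ^ 2 = 1 + τ ^ 2 := Real.sq_sqrt hs.le
  have hconst : √2 * √Real.pi * (τ / √(1 + τ ^ 2)) / ((√2 * τ) ^ 3 * (√Real.pi / 2)) * v
      = (√(1 + τ ^ 2) ^ 3)⁻¹ := by
    have hs0 : 0 < √(1 + τ ^ 2) := by positivity
    rw [hv]
    generalize √(1 + τ ^ 2) = s at hs0 hs2 ⊢
    rw [← hs2]
    field_simp
    rw [h2]
  rw [← hconst]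
  ring
end

section
/- Let κ > 0, let η ≠ 0 be a real number, and let (ω_n) be a sequence in (0, 1/2) with ω_n → 0. For each n let Z_n be a real-valued random variable with the Gaussian law N(η√n, 1) (the alternative hypothesis H₁ for the z-test). Then the truncated Bayes factor BF_n(Z_n) diverges to ∞ in probability: for every K > 0, P(BF_n(Z_n) ≤ K) → 0 as n → ∞. -/
open MeasureTheory ProbabilityTheory Filter

/-- The marginal likelihood ratio of the z-statistic under the normal-moment prior with
`τ² = κn`. -/
noncomputable def Rz (κ : ℝ) (n : ℕ) (z : ℝ) : ℝ :=
  (1 + κ * n) ^ (-(3:ℝ)/2) * oneF₁ (3/2) (1/2) (κ * n * z^2 / (2 * (1 + κ * n)))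

/-- The truncated Bayes factor for the z-test with mixture weight `ω n`. -/
noncomputable def BFz (κ : ℝ) (ω : ℕ → ℝ) (n : ℕ) (z : ℝ) : ℝ :=
  (ω n + (1 - ω n) * Rz κ n z) / ((1 - ω n) + ω n * Rz κ n z)

/-- The Pochhammer ratio `(3/2)_k / (1/2)_k` equals `2k + 1`. -/
lemma ascPochhammer_eval_three_halves (k : ℕ) :
    (ascPochhammer ℝ k).eval (3/2) = (2 * k + 1) * (ascPochhammer ℝ k).eval (1/2) := by
  induction k with
  | zero => simp
  | succ k ih =>
    rw [ascPochhammer_succ_eval, ascPochhammer_succ_eval, ih]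
    push_cast
    ring

lemma oneF₁_term (x : ℝ) (k : ℕ) :
    (ascPochhammer ℝ k).eval (3/2) / ((ascPochhammer ℝ k).eval (1/2) * (k.factorial : ℝ)) * x ^ k
      = (2 * k + 1) * (x ^ k / k.factorial) := by
  have h : (ascPochhammer ℝ k).eval (1/2) ≠ 0 := (ascPochhammer_pos k _ (by norm_num)).ne'
  have h2 : (k.factorial : ℝ) ≠ 0 := by positivity
  rw [ascPochhammer_eval_three_halves]
  field_simp

lemma two_mul_add_one_le_three_pow (k : ℕ) : (2 * k + 1 : ℝ) ≤ 3 ^ k := by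
  have h := one_add_mul_le_pow (a := (2:ℝ)) (by norm_num) k
  norm_num at h
  linarith

lemma summable_oneF₁_term {x : ℝ} (hx : 0 ≤ x) :
    Summable fun k : ℕ => (2 * k + 1 : ℝ) * (x ^ k / k.factorial) := by
  refine Summable.of_nonneg_of_le (fun k => by positivity) (fun k => ?_)
    (Real.summable_pow_div_factorial (3 * x))
  rw [mul_pow, mul_div_assoc]
  exact mul_le_mul_of_nonneg_right (two_mul_add_one_le_three_pow k) (by positivity)

lemma pow_three_le_oneF₁ {x : ℝ} (hx : 0 ≤ x) : x ^ 3 ≤ oneF₁ (3/2) (1/2) x := by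
  unfold oneF₁
  simp_rw [oneF₁_term]
  refine le_trans ?_ ((summable_oneF₁_term hx).le_tsum 3 fun k _ => by positivity)
  have := pow_nonneg hx 3
  norm_num [Nat.factorial]
  linarith

/-- If `z²` is at least of order `n`, then so is the marginal likelihood ratio. -/
lemma linear_le_Rz {κ : ℝ} (hκ : 0 < κ) {c : ℝ} (hc : 0 ≤ c) {n : ℕ} (hn : 1 ≤ n) {z : ℝ}
    (hz : c * n ≤ z ^ 2) : (κ * c / 2) ^ 3 / (1 + κ) ^ 5 * n ≤ Rz κ n z := by
  have hn' : (1:ℝ) ≤ n := by exact_mod_cast hn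
  have hn0 : (0:ℝ) < n := by linarith
  have hA : 1 ≤ 1 + κ * n := by nlinarith [mul_pos hκ hn0]
  have hA0 : 0 < 1 + κ * n := by linarith
  have hpow : ((1 + κ * n) ^ 2)⁻¹ ≤ (1 + κ * n) ^ (-(3:ℝ)/2) := by
    rw [← Real.rpow_natCast, ← Real.rpow_neg hA0.le]
    exact Real.rpow_le_rpow_of_exponent_le hA (by norm_num)
  have hx : κ * n * (c * n) / (2 * (1 + κ * n)) ≤ κ * n * z ^ 2 / (2 * (1 + κ * n)) := by
    gcongr
  have hF : (κ * n * (c * n) / (2 * (1 + κ * n))) ^ 3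
      ≤ oneF₁ (3/2) (1/2) (κ * n * z ^ 2 / (2 * (1 + κ * n))) :=
    (pow_le_pow_left₀ (by positivity) hx 3).trans (pow_three_le_oneF₁ (by positivity))
  have hAn : 1 + κ * n ≤ (1 + κ) * n := by linarith
  calc (κ * c / 2) ^ 3 / (1 + κ) ^ 5 * n
      = (κ * c / 2) ^ 3 * n ^ 6 / ((1 + κ) * n) ^ 5 := by field_simp
    _ ≤ (κ * c / 2) ^ 3 * n ^ 6 / (1 + κ * n) ^ 5 := by gcongr
    _ = ((1 + κ * n) ^ 2)⁻¹ * (κ * n * (c * n) / (2 * (1 + κ * n))) ^ 3 := by field_simp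
    _ ≤ Rz κ n z := mul_le_mul hpow hF (by positivity) (by positivity)

/-- A large likelihood ratio forces a large truncated Bayes factor once `ω n` is small. -/
lemma lt_BFz {κ K z : ℝ} {ω : ℕ → ℝ} {n : ℕ} (hK : 0 < K) (hω : 0 < ω n)
    (hωK : ω n * (1 + K) ≤ 1 / 2) (hR : 2 * K ≤ Rz κ n z) : K < BFz κ ω n z := by
  have h1 : 0 < 1 - ω n := by nlinarith [mul_pos hω hK]
  have hR0 : 0 < Rz κ n z := by linarith
  rw [BFz, lt_div_iff₀ (by positivity)]
  nlinarith [mul_pos hω hK, mul_le_mul_of_nonneg_right hωK hR0.le]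

/-- Chebyshev bound on a Gaussian variable falling below half its mean in absolute value. -/
lemma gaussianReal_sq_lt_le {m : ℝ} (hm : m ≠ 0) :
    gaussianReal m 1 {z | z ^ 2 < m ^ 2 / 4} ≤ ENNReal.ofReal (4 / m ^ 2) := by
  have hm' : 0 < |m| / 2 := by positivity
  have h := meas_ge_le_variance_div_sq (μ := gaussianReal m 1) (X := id)
    (memLp_id_gaussianReal 2) hm'
  simp only [variance_id_gaussianReal, integral_id_gaussianReal, id_eq] at h
  refine (measure_mono fun z hz => ?_).trans (h.trans_eq ?_)
  · have hz' : |z| < |m| / 2 := by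
      refine abs_lt_of_sq_lt_sq ?_ hm'.le
      rw [div_pow, sq_abs]
      norm_num at hz ⊢
      exact hz
    have := abs_sub_abs_le_abs_sub m z
    rw [abs_sub_comm] at this
    simp only [Set.mem_ofPred_eq]
    linarith
  · congr 1
    rw [div_pow, sq_abs]
    norm_num

/-- Under the alternative hypothesis `H₁` (z-statistic with law `N(η√n, 1)`, `η ≠ 0`),
with `ω_n → 0`, the truncated Bayes factor for the z-test diverges to `∞` in
probability. -/
theorem truncatedBF_z_alt_consistent (κ : ℝ) (hκ : 0 < κ) (η : ℝ) (hη : η ≠ 0)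
    (ω : ℕ → ℝ) (hω : ∀ n, ω n ∈ Set.Ioo (0:ℝ) (1/2)) (hω0 : Tendsto ω atTop (nhds 0))
    {Ω : Type*} [MeasureSpace Ω] [IsProbabilityMeasure (ℙ : Measure Ω)]
    (Z : ℕ → Ω → ℝ)
    (hZ : ∀ n, Measure.map (Z n) ℙ = gaussianReal (η * Real.sqrt n) 1) :
    ∀ K : ℝ, 0 < K →
      Tendsto (fun n => ℙ {w | BFz κ ω n (Z n w) ≤ K}) atTop (nhds 0) := by
  intro K hK
  have hC : 0 < (κ * (η ^ 2 / 4) / 2) ^ 3 / (1 + κ) ^ 5 := by positivity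
  have hlim : Tendsto (fun n : ℕ => ENNReal.ofReal (4 / (η ^ 2 * n))) atTop (nhds 0) := by
    rw [← ENNReal.ofReal_zero]
    refine ENNReal.tendsto_ofReal (Tendsto.const_div_atTop ?_ 4)
    exact tendsto_natCast_atTop_atTop.const_mul_atTop (by positivity)
  have hRev := (tendsto_natCast_atTop_atTop.const_mul_atTop hC).eventually_ge_atTop (2 * K)
  have hωK : ∀ᶠ n in atTop, ω n * (1 + K) < 1 / 2 :=
    (hω0.mul_const (1 + K)).eventually_lt_const (by norm_num)
  refine tendsto_of_tendsto_of_tendsto_of_le_of_le' tendsto_const_nhds hlim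
    (Eventually.of_forall fun n => zero_le) ?_
  filter_upwards [hRev, hωK, eventually_ge_atTop 1] with n hRn hωn hn
  have hn0 : (0:ℝ) < n := by exact_mod_cast hn
  have hsq : (η * Real.sqrt n) ^ 2 = η ^ 2 * n := by rw [mul_pow, Real.sq_sqrt hn0.le]
  have hZn : AEMeasurable (Z n) ℙ := by
    refine AEMeasurable.of_map_ne_zero ?_
    rw [hZ n]
    exact IsProbabilityMeasure.ne_zero _
  have hS : MeasurableSet {z : ℝ | z ^ 2 < (η * Real.sqrt n) ^ 2 / 4} :=
    measurableSet_lt (by fun_prop) (by fun_prop)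
  have hg := gaussianReal_sq_lt_le (mul_ne_zero hη (Real.sqrt_pos.2 hn0).ne')
  rw [← hZ n, Measure.map_apply_of_aemeasurable hZn hS, hsq] at hg
  refine (measure_mono fun w hw => ?_).trans hg
  by_contra hcon
  simp only [Set.mem_preimage, Set.mem_ofPred_eq, not_lt] at hcon hw
  have hR := linear_le_Rz hκ (c := η ^ 2 / 4) (by positivity) hn (z := Z n w) (by linarith)
  exact absurd hw (not_le.2 (lt_BFz hK (hω n).1 hωn.le (hRn.trans hR)))
end

section
/- Let τ > 0, let k be a positive integer, and let h > 0. Then ∫_0^∞ [ Σ_{i=0}^∞ e^{−λ/2} (λ/2)^i / i! · h^{k/2+i−1} e^{−h/2} / (2^{k/2+i} Γ(k/2+i)) ] · [ λ^{k/2} e^{−λ/(2τ²)} / ((2τ²)^{k/2+1} Γ(k/2+1)) ] dλ = [ h^{k/2−1} e^{−h/2} / (2^{k/2} Γ(k/2)) ] · (1+τ²)^{−(k/2+1)} · ₁F₁(k/2+1; k/2; τ² h / (2(1+τ²))). In words: the marginal density of a χ²-statistic h | λ ∼ χ²_k(λ) with non-centrality λ drawn from a Gamma(k/2+1, 1/(2τ²))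 prior equals the central χ²_k density at h times (1+τ²)^{−(k/2+1)} ₁F₁(k/2+1; k/2; τ²h/(2(1+τ²))). -/
open MeasureTheory Set in
/-- Termwise integration of a nonnegative series of unnormalised gamma densities. -/
lemma integral_tsum_mul_rpow_mul_exp_neg_mul_Ioi {s r : ℝ} (hs : 0 < s) (hr : 0 < r)
    {c : ℕ → ℝ} (hc : ∀ i, 0 ≤ c i)
    (hsum : Summable fun i : ℕ ↦ c i * ((1 / r) ^ (s + i) * Real.Gamma (s + i))) :
    ∫ t in Ioi (0 : ℝ), ∑' i : ℕ, c i * (t ^ (s + i - 1) * Real.exp (-(r * t))) =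
      ∑' i : ℕ, c i * ((1 / r) ^ (s + i) * Real.Gamma (s + i)) := by
  have hint (i : ℕ) : ∫ t in Ioi (0 : ℝ), c i * (t ^ (s + i - 1) * Real.exp (-(r * t))) =
      c i * ((1 / r) ^ (s + i) * Real.Gamma (s + i)) := by
    rw [integral_const_mul, Real.integral_rpow_mul_exp_neg_mul_Ioi (by positivity) hr]
  rw [← integral_tsum_of_summable_integral_norm]
  · exact tsum_congr hint
  · intro i
    have hi : -1 < s + i - 1 := by
      have : (0 : ℝ) ≤ i := i.cast_nonneg
      linarith
    have := integrableOn_rpow_mul_exp_neg_mul_rpow hi one_pos hr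
    simp only [Real.rpow_one, neg_mul] at this
    exact this.const_mul _
  · refine hsum.congr fun i ↦ ?_
    rw [← hint i]
    refine setIntegral_congr_fun measurableSet_Ioi fun t (ht : 0 < t) ↦ ?_
    have := hc i
    exact (Real.norm_of_nonneg (by positivity)).symm

lemma Real.Gamma_add_natCast_eq_ascPochhammer_mul {s : ℝ} (hs : 0 < s) (n : ℕ) :
    Real.Gamma (s + n) = (ascPochhammer ℝ n).eval s * Real.Gamma s := by
  induction n with
  | zero => simp
  | succ n ih =>
    rw [Nat.cast_succ, ← add_assoc, Real.Gamma_add_one (by positivity), ih,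
      ascPochhammer_succ_eval]
    ring

lemma mul_ascPochhammer_eval_add_one (a : ℝ) (n : ℕ) :
    a * (ascPochhammer ℝ n).eval (a + 1) = (a + n) * (ascPochhammer ℝ n).eval a := by
  induction n with
  | zero => simp
  | succ n ih =>
    rw [ascPochhammer_succ_eval, ascPochhammer_succ_eval, ← mul_assoc, ih]
    push_cast
    ring

lemma summable_oneF₁_add_one {a : ℝ} (ha : 0 < a) {x : ℝ} (hx : 0 ≤ x) :
    Summable fun n : ℕ ↦ (ascPochhammer ℝ n).eval (a + 1) /
      ((ascPochhammer ℝ n).eval a * (n.factorial : ℝ)) * x ^ n := by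
  have hterm (n : ℕ) : (ascPochhammer ℝ n).eval (a + 1) /
      ((ascPochhammer ℝ n).eval a * (n.factorial : ℝ)) * x ^ n =
      (1 + n / a) * (x ^ n / n.factorial) := by
    have hp := ascPochhammer_pos n a ha
    have := mul_ascPochhammer_eval_add_one a n
    field_simp
    linear_combination x ^ n * this
  simp only [hterm]
  refine .of_nonneg_of_le (fun n ↦ by positivity) (fun n ↦ ?_)
    ((Real.summable_pow_div_factorial (2 * x)).mul_left (1 + 1 / a))
  have hn : (n : ℝ) ≤ 2 ^ n := by exact_mod_cast n.lt_two_pow_self.le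
  have h1 : (1 : ℝ) ≤ 2 ^ n := one_le_pow₀ one_le_two
  calc (1 + n / a) * (x ^ n / n.factorial)
      ≤ (2 ^ n + 2 ^ n / a) * (x ^ n / n.factorial) := by gcongr
    _ = (1 + 1 / a) * ((2 * x) ^ n / n.factorial) := by rw [mul_pow]; ring


/-- Marginal density of a χ²-statistic `h | λ ∼ χ²_k(λ)` with non-centrality `λ` drawn
from a `Gamma(k/2+1, 1/(2τ²))` prior: it equals the central `χ²_k` density at `h` times
`(1+τ²)^{−(k/2+1)} ₁F₁(k/2+1; k/2; τ²h/(2(1+τ²)))`. -/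
theorem chiSq_marginal_gamma_prior (τ : ℝ) (hτ : 0 < τ) (k : ℕ) (hk : 0 < k)
    (h : ℝ) (hh : 0 < h) :
    ∫ lam in Set.Ioi (0:ℝ),
      (∑' i : ℕ, Real.exp (-lam/2) * (lam/2)^i / (i.factorial : ℝ) *
        (h ^ ((k:ℝ)/2 + i - 1) * Real.exp (-h/2) /
          ((2:ℝ) ^ ((k:ℝ)/2 + i) * Real.Gamma ((k:ℝ)/2 + i)))) *
      (lam ^ ((k:ℝ)/2) * Real.exp (-lam/(2*τ^2)) /
        ((2*τ^2) ^ ((k:ℝ)/2 + 1) * Real.Gamma ((k:ℝ)/2 + 1)))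
    = (h ^ ((k:ℝ)/2 - 1) * Real.exp (-h/2) / ((2:ℝ) ^ ((k:ℝ)/2) * Real.Gamma ((k:ℝ)/2))) *
      (1+τ^2) ^ (-((k:ℝ)/2 + 1)) *
      oneF₁ ((k:ℝ)/2 + 1) ((k:ℝ)/2) (τ^2 * h / (2*(1+τ^2))) := by
  set a : ℝ := (k : ℝ) / 2 with ha_def
  have ha : 0 < a := by positivity
  clear_value a
  set r : ℝ := (1 + τ ^ 2) / (2 * τ ^ 2) with hr_def
  have hr : 0 < r := by positivity
  set c : ℕ → ℝ := fun i ↦ (1 / 2) ^ i / (i.factorial : ℝ) *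
    (h ^ (a + i - 1) * Real.exp (-h / 2) / ((2 : ℝ) ^ (a + i) * Real.Gamma (a + i))) /
    ((2 * τ ^ 2) ^ (a + 1) * Real.Gamma (a + 1)) with hc_def
  have hc (i : ℕ) : 0 ≤ c i := by
    have := Real.Gamma_pos_of_pos (by positivity : 0 < a + i)
    have := Real.Gamma_pos_of_pos (by positivity : 0 < a + 1)
    positivity
  have hterm (i : ℕ) : c i * ((1 / r) ^ (a + 1 + i) * Real.Gamma (a + 1 + i)) =
      (h ^ (a - 1) * Real.exp (-h / 2) / ((2 : ℝ) ^ a * Real.Gamma a)) *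
        (1 + τ ^ 2) ^ (-(a + 1)) *
        ((ascPochhammer ℝ i).eval (a + 1) / ((ascPochhammer ℝ i).eval a * (i.factorial : ℝ)) *
          (τ ^ 2 * h / (2 * (1 + τ ^ 2))) ^ i) := by
    have hG := Real.Gamma_pos_of_pos ha
    have hG1 := Real.Gamma_pos_of_pos (by positivity : 0 < a + 1)
    have hp := ascPochhammer_pos i a ha
    have hinv : (1 / r) ^ (a + 1) = (2 * τ ^ 2) ^ (a + 1) * (1 + τ ^ 2) ^ (-(a + 1)) := by
      rw [hr_def, one_div_div, Real.div_rpow (by positivity) (by positivity),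
        Real.rpow_neg (by positivity), div_eq_mul_inv]
    have hx : (τ ^ 2 * h / (2 * (1 + τ ^ 2))) ^ i = (1 / 2) ^ i * h ^ i / 2 ^ i * (1 / r) ^ i := by
      rw [← mul_pow, ← div_pow, ← mul_pow, hr_def]
      congr 1
      field_simp
    rw [hx, Real.rpow_add_natCast (by positivity), hinv, hc_def]
    simp only
    rw [add_sub_right_comm, Real.rpow_add_natCast hh.ne', Real.rpow_add_natCast two_ne_zero,
      Real.Gamma_add_natCast_eq_ascPochhammer_mul ha,
      Real.Gamma_add_natCast_eq_ascPochhammer_mul (by positivity : 0 < a + 1)]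
    have : 0 < (2 * τ ^ 2) ^ (a + 1) := by positivity
    generalize (2 * τ ^ 2) ^ (a + 1) = u at *
    field_simp
  rw [oneF₁, ← tsum_mul_left, ← tsum_congr hterm,
    ← integral_tsum_mul_rpow_mul_exp_neg_mul_Ioi (by positivity) hr hc]
  · refine MeasureTheory.setIntegral_congr_fun measurableSet_Ioi fun t (ht : 0 < t) ↦ ?_
    rw [← tsum_mul_right]
    refine tsum_congr fun i ↦ ?_
    have hexp : Real.exp (-(r * t)) = Real.exp (-t / 2) * Real.exp (-t / (2 * τ ^ 2)) := by
      rw [← Real.exp_add, hr_def]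
      congr 1
      field_simp
      ring
    rw [hexp, show a + 1 + i - 1 = a + i by ring, Real.rpow_add_natCast ht.ne' a i, hc_def]
    simp only [div_pow, one_pow]
    ring
  · simp only [hterm]
    exact (summable_oneF₁_add_one ha (by positivity)).mul_left _
end

section
/- Let τ > 0, let a and b be positive integers, and let f > 0. Then ∫_0^∞ [ Σ_{i=0}^∞ e^{−λ/2} (λ/2)^i / i! · ( Γ((a+b)/2+i) / (Γ(a/2+i) Γ(b/2)) ) (a/b)^{a/2+i} f^{a/2+i−1} (1 + af/b)^{−((a+b)/2+i)} ] · [ λ^{a/2} e^{−λ/(2τ²)} / ((2τ²)^{a/2+1} Γ(a/2+1)) ] dλ = m_0(f) · (1+τ²)^{−(a/2+1)} · ₂F₁( a/2+1, (a+b)/2; a/2; a f τ² / ((1+τ²)(b+af)) ), where m_0(f) = ( Γ((a+b)/2) / (Γ(a/2) Γ(b/2)) ) (a/b)^{a/2} f^{a/2−1} (1 + af/b)^{−(a+b)/2} is the central F_{a,b} density at f. In words: the marginal density of an F-statistic f | λ ∼ F_{a,b}(λ) with non-centrality λ drawn from a Gamma(a/2+1, 1/(2τ²)) prior equals the central F density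 times (1+τ²)^{−(a/2+1)} ₂F₁(a/2+1, (a+b)/2; a/2; afτ²/((1+τ²)(b+af))). -/
/-- The Gaussian hypergeometric series `₂F₁(a, b; c; x)`. -/
noncomputable def twoF₁ (a b c x : ℝ) : ℝ :=
  ∑' k : ℕ, (ascPochhammer ℝ k).eval a * (ascPochhammer ℝ k).eval b /
    ((ascPochhammer ℝ k).eval c * (k.factorial : ℝ)) * x ^ k

open MeasureTheory

theorem MeasureTheory.Integrable.of_integral_pos {α : Type*} [MeasurableSpace α] {μ : Measure α}
    {g : α → ℝ} (h : 0 < ∫ x, g x ∂μ) : Integrable g μ := by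
  by_contra hg
  exact h.ne' (integral_undef hg)

theorem Real.Gamma_add_natCast {x : ℝ} (hx : 0 < x) (n : ℕ) :
    Real.Gamma (x + n) = (ascPochhammer ℝ n).eval x * Real.Gamma x := by
  induction n with
  | zero => simp
  | succ n ih =>
    have h : x + n ≠ 0 := by positivity
    rw [Nat.cast_succ, ← add_assoc, Real.Gamma_add_one h, ih, ascPochhammer_succ_eval]
    ring

theorem twoF₁_summable {a b c x : ℝ} (ha : 0 < a) (hb : 0 < b) (hc : 0 < c) (hx : |x| < 1) :
    Summable fun k : ℕ ↦ (ascPochhammer ℝ k).eval a * (ascPochhammer ℝ k).eval b /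
      ((ascPochhammer ℝ k).eval c * (k.factorial : ℝ)) * x ^ k := by
  have hr : (ordinaryHypergeometricSeries ℝ a b c).radius = 1 :=
    ordinaryHypergeometricSeries_radius_eq_one ℝ a b c fun k ↦ by
      have hk : (0 : ℝ) ≤ k := k.cast_nonneg
      exact ⟨by linarith, by linarith, by linarith⟩
  have hmem : x ∈ Metric.eball (0 : ℝ) (ordinaryHypergeometricSeries ℝ a b c).radius := by
    rw [hr, ← ENNReal.ofReal_one, Metric.eball_ofReal]
    simpa using hx
  refine ((ordinaryHypergeometricSeries ℝ a b c).summable_norm_apply hmem).of_norm.congr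
    fun k ↦ ?_
  rw [ordinaryHypergeometricSeries_apply_eq, smul_eq_mul]
  field_simp

/-- The `i`-th Poisson weight with parameter `l / 2`, mixed over a `Gamma(s, 1/(2t))` prior
on `l`, is a negative binomial weight. -/
theorem integral_poisson_mul_gamma {s t : ℝ} (hs : 0 < s) (ht : 0 < t) (i : ℕ) :
    ∫ l in Set.Ioi (0 : ℝ), Real.exp (-l / 2) * (l / 2) ^ i / (i.factorial : ℝ) *
      (l ^ (s - 1) * Real.exp (-l / (2 * t)) / ((2 * t) ^ s * Real.Gamma s)) =
    (1 + t) ^ (-s) * ((ascPochhammer ℝ i).eval s / (i.factorial : ℝ) * (t / (1 + t)) ^ i) := by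
  have hG := (Real.Gamma_pos_of_pos hs).ne'
  have h1t : 0 < 1 + t := by positivity
  have hint : ∀ l ∈ Set.Ioi (0 : ℝ), Real.exp (-l / 2) * (l / 2) ^ i / (i.factorial : ℝ) *
      (l ^ (s - 1) * Real.exp (-l / (2 * t)) / ((2 * t) ^ s * Real.Gamma s)) =
      (1 / 2 ^ i / (i.factorial : ℝ) / ((2 * t) ^ s * Real.Gamma s)) *
        (l ^ (s + i - 1) * Real.exp (-((1 + t) / (2 * t) * l))) := by
    intro l hl
    have he : Real.exp (-((1 + t) / (2 * t) * l)) =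
        Real.exp (-l / 2) * Real.exp (-l / (2 * t)) := by
      rw [← Real.exp_add]
      congr 1
      field_simp
      ring
    have hp : l ^ (s + i - 1) = l ^ (s - 1) * l ^ i := by
      rw [← Real.rpow_natCast l i, ← Real.rpow_add hl]
      ring_nf
    rw [he, hp, div_pow]
    ring
  rw [setIntegral_congr_fun measurableSet_Ioi hint, integral_const_mul,
    Real.integral_rpow_mul_exp_neg_mul_Ioi (by positivity) (by positivity),
    Real.Gamma_add_natCast hs, one_div_div, Real.rpow_add (by positivity), Real.rpow_natCast,
    Real.div_rpow (by positivity) h1t.le, Real.rpow_neg h1t.le, div_pow, div_pow, mul_pow]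
  have h2 : (2 * t) ^ s ≠ 0 := by positivity
  have h3 : (1 + t) ^ s ≠ 0 := by positivity
  field_simp

/-- The density of `F_{a+2i,b}`, rescaled to degrees of freedom `(a, b)`, as a multiple of the
central `F_{a,b}` density. -/
theorem F_density_term_eq {a b f : ℝ} (ha : 0 < a) (hb : 0 < b) (hf : 0 < f) (i : ℕ) :
    Real.Gamma ((a + b) / 2 + i) / (Real.Gamma (a / 2 + i) * Real.Gamma (b / 2)) *
      (a / b) ^ (a / 2 + i) * f ^ (a / 2 + i - 1) * (1 + a * f / b) ^ (-((a + b) / 2 + i)) =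
    (Real.Gamma ((a + b) / 2) / (Real.Gamma (a / 2) * Real.Gamma (b / 2)) *
      (a / b) ^ (a / 2) * f ^ (a / 2 - 1) * (1 + a * f / b) ^ (-((a + b) / 2))) *
      ((ascPochhammer ℝ i).eval ((a + b) / 2) / (ascPochhammer ℝ i).eval (a / 2) *
        (a * f / (b + a * f)) ^ i) := by
  have hw : 0 < 1 + a * f / b := by positivity
  have hy : a * f / (b + a * f) = a / b * f / (1 + a * f / b) := by field_simp
  have hA := (ascPochhammer_pos i (a / 2) (by positivity)).ne'
  have hG := (Real.Gamma_pos_of_pos (half_pos ha)).ne'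
  have hGb := (Real.Gamma_pos_of_pos (half_pos hb)).ne'
  rw [Real.Gamma_add_natCast (by positivity), Real.Gamma_add_natCast (by positivity),
    Real.rpow_add (by positivity), add_sub_right_comm, Real.rpow_add hf, neg_add,
    Real.rpow_add hw, Real.rpow_neg hw.le (i : ℝ), Real.rpow_natCast, Real.rpow_natCast,
    Real.rpow_natCast, hy, div_pow (a / b * f), mul_pow (a / b)]
  generalize (a / b) ^ (a / 2) = u, (a / b) ^ i = v, (1 + a * f / b) ^ (-((a + b) / 2)) = z,
    (1 + a * f / b) ^ i = w
  field_simp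

/-- Marginal density of an F-statistic `f | λ ∼ F_{a,b}(λ)` with non-centrality `λ`
drawn from a `Gamma(a/2+1, 1/(2τ²))` prior: it equals the central `F_{a,b}` density at
`f` times `(1+τ²)^{−(a/2+1)} ₂F₁(a/2+1, (a+b)/2; a/2; afτ²/((1+τ²)(b+af)))`. -/
theorem F_marginal_gamma_prior (τ : ℝ) (hτ : 0 < τ) (a b : ℕ) (ha : 0 < a) (hb : 0 < b)
    (f : ℝ) (hf : 0 < f) :
    ∫ lam in Set.Ioi (0:ℝ),
      (∑' i : ℕ, Real.exp (-lam/2) * (lam/2)^i / (i.factorial : ℝ) *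
        (Real.Gamma (((a:ℝ)+(b:ℝ))/2 + i) /
            (Real.Gamma ((a:ℝ)/2 + i) * Real.Gamma ((b:ℝ)/2)) *
          ((a:ℝ)/(b:ℝ)) ^ ((a:ℝ)/2 + i) * f ^ ((a:ℝ)/2 + i - 1) *
          (1 + (a:ℝ)*f/(b:ℝ)) ^ (-(((a:ℝ)+(b:ℝ))/2 + i)))) *
      (lam ^ ((a:ℝ)/2) * Real.exp (-lam/(2*τ^2)) /
        ((2*τ^2) ^ ((a:ℝ)/2 + 1) * Real.Gamma ((a:ℝ)/2 + 1)))
    = (Real.Gamma (((a:ℝ)+(b:ℝ))/2) / (Real.Gamma ((a:ℝ)/2) * Real.Gamma ((b:ℝ)/2)) *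
        ((a:ℝ)/(b:ℝ)) ^ ((a:ℝ)/2) * f ^ ((a:ℝ)/2 - 1) *
        (1 + (a:ℝ)*f/(b:ℝ)) ^ (-(((a:ℝ)+(b:ℝ))/2))) *
      ((1+τ^2) ^ (-((a:ℝ)/2 + 1)) *
        twoF₁ ((a:ℝ)/2 + 1) (((a:ℝ)+(b:ℝ))/2) ((a:ℝ)/2)
          ((a:ℝ)*f*τ^2 / ((1+τ^2)*((b:ℝ)+(a:ℝ)*f)))) := by
  have ha' : (0 : ℝ) < a := Nat.cast_pos.2 ha
  have hb' : (0 : ℝ) < b := Nat.cast_pos.2 hb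
  simp_rw [F_density_term_eq ha' hb' hf, ← tsum_mul_right]
  set m := Real.Gamma (((a:ℝ)+(b:ℝ))/2) / (Real.Gamma ((a:ℝ)/2) * Real.Gamma ((b:ℝ)/2)) *
        ((a:ℝ)/(b:ℝ)) ^ ((a:ℝ)/2) * f ^ ((a:ℝ)/2 - 1) *
        (1 + (a:ℝ)*f/(b:ℝ)) ^ (-(((a:ℝ)+(b:ℝ))/2)) with hm
  set x := (a:ℝ)*f*τ^2 / ((1+τ^2)*((b:ℝ)+(a:ℝ)*f)) with hx
  have hx1 : |x| < 1 := by
    rw [abs_of_pos (by positivity), hx, div_lt_one (by positivity)]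
    nlinarith [mul_pos ha' hf, mul_pos hb' (pow_pos hτ 2)]
  set F : ℕ → ℝ → ℝ := fun i l ↦ Real.exp (-l/2) * (l/2)^i / (i.factorial : ℝ) *
    (m * ((ascPochhammer ℝ i).eval (((a:ℝ)+b)/2) / (ascPochhammer ℝ i).eval ((a:ℝ)/2) *
      (a * f / (b + a * f)) ^ i)) *
    (l ^ ((a:ℝ)/2) * Real.exp (-l/(2*τ^2)) /
      ((2*τ^2) ^ ((a:ℝ)/2 + 1) * Real.Gamma ((a:ℝ)/2 + 1))) with hF
  have hA (i : ℕ) := ascPochhammer_pos i ((a : ℝ) / 2) (by positivity)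
  have hN (i : ℕ) := ascPochhammer_pos i (((a : ℝ) + b) / 2) (by positivity)
  have hS (i : ℕ) := ascPochhammer_pos i ((a : ℝ) / 2 + 1) (by positivity)
  have hFint (i : ℕ) : ∫ l in Set.Ioi (0 : ℝ), F i l =
      m * (1 + τ ^ 2) ^ (-((a : ℝ) / 2 + 1)) *
        ((ascPochhammer ℝ i).eval ((a : ℝ) / 2 + 1) *
          (ascPochhammer ℝ i).eval (((a : ℝ) + b) / 2) /
          ((ascPochhammer ℝ i).eval ((a : ℝ) / 2) * (i.factorial : ℝ)) * x ^ i) := by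
    have h := integral_poisson_mul_gamma (s := (a : ℝ) / 2 + 1) (by positivity) (pow_pos hτ 2) i
    rw [add_sub_cancel_right] at h
    have hxy : x = a * f / (b + a * f) * (τ ^ 2 / (1 + τ ^ 2)) := by rw [hx]; field_simp
    simp_rw [hF, mul_right_comm _ (m * _)]
    rw [integral_mul_const, h, hxy, mul_pow]
    field_simp
  have hmpos : 0 < m := by
    have h1 := Real.Gamma_pos_of_pos (half_pos (add_pos ha' hb'))
    have h2 := Real.Gamma_pos_of_pos (half_pos ha')
    have h3 := Real.Gamma_pos_of_pos (half_pos hb')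
    positivity
  have hFi (i : ℕ) : IntegrableOn (F i) (Set.Ioi 0) := by
    refine Integrable.of_integral_pos ?_
    rw [hFint]
    have := hA i
    have := hN i
    have := hS i
    positivity
  have hnorm (i : ℕ) : ∫ l in Set.Ioi (0 : ℝ), ‖F i l‖ = ∫ l in Set.Ioi (0 : ℝ), F i l := by
    refine setIntegral_congr_fun measurableSet_Ioi fun l (hl : 0 < l) ↦ Real.norm_of_nonneg ?_
    have := hA i
    have := hN i
    have := Real.Gamma_pos_of_pos (show 0 < (a : ℝ) / 2 + 1 by positivity)
    simp only [hF]
    positivity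
  have hsum := twoF₁_summable (a := (a : ℝ) / 2 + 1) (b := ((a : ℝ) + b) / 2) (by positivity)
    (by positivity) (half_pos ha') hx1
  rw [← integral_tsum_of_summable_integral_norm hFi, tsum_congr hFint, tsum_mul_left,
    twoF₁, mul_assoc]
  simp_rw [hnorm, hFint]
  exact hsum.mul_left _
end
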